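/- Fix $n \ge 1$ and $b > 0$. Consider positions $x \colon \operatorname{Fin} n \to \mathbb{R}$ with minimum $m$ and maximum $M$, and one synchronous update step: each robot at position $m$ (when $m < M$) moves to $m + b$, each robot at position $M$ (when $m < M$) moves to $M - b$, and all other robots stay put. If $M - m \le 2b$, then after the update step the new maximum minus the new minimum is still at most $2b$. -/

import Mathlib

/-- The minimum position of the `n` robots. -/
noncomputable def lo {n : ℕ} (hn : 1 ≤ n) (x : Fin n → ℝ) : ℝ :=
  Finset.univ.inf' ⟨⟨0, hn⟩, Finset.mem_univ _⟩ x

/-- The maximum position of the `n` robots. -/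
noncomputable def hi {n : ℕ} (hn : 1 ≤ n) (x : Fin n → ℝ) : ℝ :=
  Finset.univ.sup' ⟨⟨0, hn⟩, Finset.mem_univ _⟩ x

/-- One synchronous round of the one-dimensional OLA boundary-movement dynamics:
with `m = lo hn x` and `M = hi hn x`, if `m < M` then every robot at the minimum
moves to `m + b`, every robot at the maximum moves to `M - b`, and all other
robots stay put. -/
noncomputable def step {n : ℕ} (hn : 1 ≤ n) (b : ℝ) (x : Fin n → ℝ) : Fin n → ℝ :=
  fun i =>
    if lo hn x < hi hn x then
      if x i = lo hn x then x i + b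
      else if x i = hi hn x then x i - b
      else x i
    else x i

theorem lo_le {n : ℕ} (hn : 1 ≤ n) (x : Fin n → ℝ) (i : Fin n) : lo hn x ≤ x i :=
  Finset.inf'_le _ (Finset.mem_univ i)

theorem le_hi {n : ℕ} (hn : 1 ≤ n) (x : Fin n → ℝ) (i : Fin n) : x i ≤ hi hn x :=
  Finset.le_sup' _ (Finset.mem_univ i)

theorem exists_eq_lo {n : ℕ} (hn : 1 ≤ n) (x : Fin n → ℝ) : ∃ i, lo hn x = x i := by
  obtain ⟨i, -, hi⟩ := Finset.exists_mem_eq_inf' ⟨⟨0, hn⟩, Finset.mem_univ _⟩ x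
  exact ⟨i, hi⟩

theorem exists_eq_hi {n : ℕ} (hn : 1 ≤ n) (x : Fin n → ℝ) : ∃ i, hi hn x = x i := by
  obtain ⟨i, -, hi⟩ := Finset.exists_mem_eq_sup' ⟨⟨0, hn⟩, Finset.mem_univ _⟩ x
  exact ⟨i, hi⟩

/-- Invariance part of the paper's Theorem on Algorithm ConvergeQuadrant: once the
extent in a dimension is at most `2b`, it never exceeds `2b` again. -/
theorem stmt_8 (n : ℕ) (hn : 1 ≤ n) (b : ℝ) (hb : 0 < b) (x : Fin n → ℝ)
    (h : hi hn x - lo hn x ≤ 2 * b) :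
    hi hn (step hn b x) - lo hn (step hn b x) ≤ 2 * b := by
  obtain ⟨i, h_max⟩ := exists_eq_hi hn (step hn b x)
  obtain ⟨j, h_min⟩ := exists_eq_lo hn (step hn b x)
  rw [h_max, h_min]
  have hi₁ := lo_le hn x i
  have hi₂ := le_hi hn x i
  have hj₁ := lo_le hn x j
  have hj₂ := le_hi hn x j
  unfold step
  split_ifs <;> linarith
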